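/- arXiv:2407.21119 — 2 statements merged into one kernel-verified Lean document; each statement's English description precedes it below -/
import Mathlib

section
/- Consistency of estimated implicit designs in the exactly determined cross-sectional case: suppose T = 1 and k = J (where 𝒲 has J+1 elements), and assume (i) the estimand τ is a vector of causal contrasts under π* (level irrelevance), (ii) the smallest singular value σ_{iJ} of the k×(J+1) potential-weight matrix R_i = [ρ_i(0),…,ρ_i(J)] satisfies liminf_{n→∞} min_{i∈{1,…,n}} σ_{iJ} > ε > 0, and (iii) the estimated potential weights are uniformly consistent: max_{i,w} |ρ̂_i(w) − ρ_i(w)|_∞ → 0 in probability. Then there exists C > 0 such that, with probability tending to one, there exists a unique estimated implicit design π̂ with max_i max_{w∈𝒲} |π̂_i(w)| ≤ C. Moreover, defining π̂ to be such an estimated implicit design when one exists and an arbitrary vector of probability distributions otherwise, π̂ is uniformly consistent for π*: max_{i∈{1,…,n}, w∈𝒲} |π̂_i(w) − π*_i(w)| → 0 in probability. -/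
open Matrix BigOperators Filter MeasureTheory

namespace Stmt17

/-- Population Gram matrix (cross-sectional case `T = 1`, `𝒲 = {0,…,J}`). -/
noncomputable def gramPop (J K : ℕ) (z : ℕ → Fin (J + 1) → Fin K → ℝ)
    (n : ℕ) (P : Measure (Fin n → Fin (J + 1))) : Matrix (Fin K) (Fin K) ℝ :=
  (n : ℝ)⁻¹ • ∑ i : Fin n, ∑ w : Fin (J + 1),
    (P {ω | ω i = w}).toReal • vecMulVec (z i w) (z i w)

/-- Sample Gram matrix at a realized assignment `ω`. -/
noncomputable def gramHat (J K : ℕ) (z : ℕ → Fin (J + 1) → Fin K → ℝ)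
    (n : ℕ) (ω : Fin n → Fin (J + 1)) : Matrix (Fin K) (Fin K) ℝ :=
  (n : ℝ)⁻¹ • ∑ i : Fin n, vecMulVec (z i (ω i)) (z i (ω i))

/-- Population potential weights `ρ_i(w) = Λ G_n⁻¹ z(x_i,w) ∈ ℝ^J`. -/
noncomputable def rho (J K : ℕ) (z : ℕ → Fin (J + 1) → Fin K → ℝ)
    (Λ : Matrix (Fin J) (Fin K) ℝ) (n : ℕ) (P : Measure (Fin n → Fin (J + 1)))
    (i : Fin n) (w : Fin (J + 1)) : Fin J → ℝ :=
  (Λ * (gramPop J K z n P)⁻¹) *ᵥ z i w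

/-- Estimated potential weights `ρ̂_i(w) = Λ Ĝ_n⁻¹ z(x_i,w)`. -/
noncomputable def rhoHat (J K : ℕ) (z : ℕ → Fin (J + 1) → Fin K → ℝ)
    (Λ : Matrix (Fin J) (Fin K) ℝ) (n : ℕ) (ω : Fin n → Fin (J + 1))
    (i : Fin n) (w : Fin (J + 1)) : Fin J → ℝ :=
  (Λ * (gramHat J K z n ω)⁻¹) *ᵥ z i w

/-- The `J × (J+1)` potential-weight matrix `R_i = [ρ_i(0),…,ρ_i(J)]`. -/
noncomputable def Rmat (J K : ℕ) (z : ℕ → Fin (J + 1) → Fin K → ℝ)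
    (Λ : Matrix (Fin J) (Fin K) ℝ) (n : ℕ) (P : Measure (Fin n → Fin (J + 1)))
    (i : Fin n) : Matrix (Fin J) (Fin (J + 1)) ℝ :=
  Matrix.of fun a w => rho J K z Λ n P i w a

/-- The regression estimand as a function of the potential outcomes. -/
noncomputable def tau (J K : ℕ) (z : ℕ → Fin (J + 1) → Fin K → ℝ)
    (Λ : Matrix (Fin J) (Fin K) ℝ) (n : ℕ) (P : Measure (Fin n → Fin (J + 1)))
    (y : Fin n → Fin (J + 1) → ℝ) : Fin J → ℝ :=
  (Λ * (gramPop J K z n P)⁻¹) *ᵥ ((n : ℝ)⁻¹ •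
    ∑ i : Fin n, ∑ w : Fin (J + 1), ((P {ω | ω i = w}).toReal * y i w) • z i w)

/-- Level irrelevance of the estimand under the marginals of `P`. -/
def LevelIrrelevance (J K : ℕ) (z : ℕ → Fin (J + 1) → Fin K → ℝ)
    (Λ : Matrix (Fin J) (Fin K) ℝ) (n : ℕ) (P : Measure (Fin n → Fin (J + 1))) : Prop :=
  ∀ (y : Fin n → Fin (J + 1) → ℝ) (c : Fin n → ℝ),
    tau J K z Λ n P (fun i w => y i w + c i) = tau J K z Λ n P y

/-- `q` is an estimated implicit design at the realization `ω`. -/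
def EstImplicitDesign (J K : ℕ) (z : ℕ → Fin (J + 1) → Fin K → ℝ)
    (Λ : Matrix (Fin J) (Fin K) ℝ) (n : ℕ) (ω : Fin n → Fin (J + 1))
    (q : Fin n → Fin (J + 1) → ℝ) : Prop :=
  (∀ (i : Fin n) (a : Fin J), ∑ w : Fin (J + 1), q i w * rhoHat J K z Λ n ω i w a = 0)
  ∧ (∀ i, ∑ w : Fin (J + 1), q i w = 1)

lemma aux_dot_nonneg {m : ℕ} (v : Fin m → ℝ) : 0 ≤ v ⬝ᵥ v :=
  Finset.sum_nonneg fun i _ => mul_self_nonneg (v i)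

lemma aux_bound (J : ℕ) (R : Matrix (Fin J) (Fin (J + 1)) ℝ) (p : Fin (J + 1) → ℝ)
    (hp1 : ∑ w, p w = 1) (hpp : p ⬝ᵥ p ≤ 1) (hRp : R *ᵥ p = 0)
    (ε : ℝ) (hε : 0 < ε)
    (hσ : ∀ v : Fin J → ℝ, ε ^ 2 * (v ⬝ᵥ v) ≤ v ⬝ᵥ ((R * Rᵀ) *ᵥ v))
    (q : Fin (J + 1) → ℝ) (hq : ∑ w, q w = 0) :
    ε ^ 2 * (q ⬝ᵥ q) ≤ 2 * (J + 2) * ((R *ᵥ q) ⬝ᵥ (R *ᵥ q)) := by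
  have hinj : Function.Injective (R * Rᵀ).mulVecLin := by
    rw [injective_iff_map_eq_zero]
    intro v hv
    have h := hσ v
    rw [Matrix.mulVecLin_apply] at hv
    rw [hv, dotProduct_zero] at h
    have h0 : 0 ≤ v ⬝ᵥ v := aux_dot_nonneg v
    have h2 : 0 < ε ^ 2 := by positivity
    have : v ⬝ᵥ v = 0 := by nlinarith
    exact dotProduct_self_eq_zero.mp this
  have hsurj : Function.Surjective (R * Rᵀ).mulVecLin := LinearMap.injective_iff_surjective.mp hinj
  have hRsurj : Function.Surjective R.mulVecLin := by
    intro r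
    obtain ⟨v, hv⟩ := hsurj r
    refine ⟨Rᵀ *ᵥ v, ?_⟩
    rw [← hv]
    rw [Matrix.mulVecLin_apply, Matrix.mulVecLin_apply, Matrix.mulVec_mulVec]
  have hker : Module.finrank ℝ (LinearMap.ker R.mulVecLin) = 1 := by
    have h := LinearMap.finrank_range_add_finrank_ker R.mulVecLin
    rw [LinearMap.range_eq_top.mpr hRsurj] at h
    simp at h
    omega
  have hp0 : p ≠ 0 := by
    rintro rfl
    simp at hp1
  obtain ⟨v, hv⟩ := hsurj (R *ᵥ q)
  rw [Matrix.mulVecLin_apply] at hv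
  set u := Rᵀ *ᵥ v with hu
  have hRu : R *ᵥ u = R *ᵥ q := by rw [hu, Matrix.mulVec_mulVec, hv]
  have huu : u ⬝ᵥ u = v ⬝ᵥ (R *ᵥ q) := by
    rw [← hRu]
    conv_lhs => rw [hu]
    rw [Matrix.mulVec_transpose, ← Matrix.dotProduct_mulVec]
    rw [← Matrix.mulVec_transpose]
  have hcs : (v ⬝ᵥ (R *ᵥ q)) ^ 2 ≤ (v ⬝ᵥ v) * ((R *ᵥ q) ⬝ᵥ (R *ᵥ q)) := by
    simpa [dotProduct, sq] using Finset.sum_mul_sq_le_sq_mul_sq Finset.univ v (R *ᵥ q)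
  have hσv := hσ v
  rw [hv, ← huu] at hσv
  rw [← huu] at hcs
  have hr0 : 0 ≤ (R *ᵥ q) ⬝ᵥ (R *ᵥ q) := aux_dot_nonneg _
  have hu0 : 0 ≤ u ⬝ᵥ u := aux_dot_nonneg _
  have hub : ε ^ 2 * (u ⬝ᵥ u) ≤ (R *ᵥ q) ⬝ᵥ (R *ᵥ q) := by
    rcases hu0.eq_or_lt with h | h
    · rw [← h]; simpa using hr0
    · have : (u ⬝ᵥ u) * (ε ^ 2 * (u ⬝ᵥ u)) ≤ (u ⬝ᵥ u) * ((R *ᵥ q) ⬝ᵥ (R *ᵥ q)) := by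
        have h2 := mul_le_mul_of_nonneg_left hcs (sq_nonneg ε)
        have h3 := mul_le_mul_of_nonneg_right hσv hr0
        nlinarith
      exact le_of_mul_le_mul_left this h
  have hpk : p ∈ LinearMap.ker R.mulVecLin := by simpa using hRp
  have hqk : q - u ∈ LinearMap.ker R.mulVecLin := by
    simp [Matrix.mulVec_sub, hRu]
  obtain ⟨c, hc⟩ := (finrank_eq_one_iff_of_nonzero' (⟨p, hpk⟩ : LinearMap.ker R.mulVecLin)
    (by simpa using hp0)).mp hker ⟨q - u, hqk⟩
  have hc' : ∀ w, q w = u w + c * p w := by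
    intro w
    have := congrFun (congrArg Subtype.val hc) w
    simp at this
    linarith
  have hcs2 : c = - ∑ w, u w := by
    simp only [hc', Finset.sum_add_distrib, ← Finset.mul_sum, hp1] at hq
    linarith
  have hc2 : c ^ 2 ≤ (J + 1) * (u ⬝ᵥ u) := by
    rw [hcs2, neg_sq]
    have := sq_sum_le_card_mul_sum_sq (s := Finset.univ) (f := u)
    simpa [dotProduct, sq] using this
  have hqq : q ⬝ᵥ q ≤ 2 * (u ⬝ᵥ u) + 2 * (c ^ 2 * (p ⬝ᵥ p)) := by
    simp only [dotProduct, Finset.mul_sum, ← Finset.sum_add_distrib]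
    refine Finset.sum_le_sum fun w _ => ?_
    rw [hc' w]
    nlinarith [sq_nonneg (u w - c * p w)]
  have hcp : c ^ 2 * (p ⬝ᵥ p) ≤ (J + 1) * (u ⬝ᵥ u) :=
    (mul_le_of_le_one_right (sq_nonneg c) hpp).trans hc2
  have h1 : q ⬝ᵥ q ≤ 2 * (J + 2) * (u ⬝ᵥ u) := by nlinarith
  calc ε ^ 2 * (q ⬝ᵥ q) ≤ ε ^ 2 * (2 * (J + 2) * (u ⬝ᵥ u)) := by gcongr
    _ = 2 * (J + 2) * (ε ^ 2 * (u ⬝ᵥ u)) := by ring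
    _ ≤ _ := by gcongr

lemma aux_E (J : ℕ) (E : Matrix (Fin J) (Fin (J + 1)) ℝ) (δ : ℝ)
    (hE : ∀ a w, |E a w| ≤ δ) (q : Fin (J + 1) → ℝ) :
    (E *ᵥ q) ⬝ᵥ (E *ᵥ q) ≤ J * (J + 1) * δ ^ 2 * (q ⬝ᵥ q) := by
  have h : ∀ a, (E *ᵥ q) a * (E *ᵥ q) a ≤ (J + 1) * δ ^ 2 * (q ⬝ᵥ q) := by
    intro a
    have h1 := Finset.sum_mul_sq_le_sq_mul_sq Finset.univ (E a) q
    have h2 : ∑ w, E a w ^ 2 ≤ (J + 1) * δ ^ 2 := by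
      calc ∑ w, E a w ^ 2 ≤ ∑ w : Fin (J + 1), δ ^ 2 :=
            Finset.sum_le_sum fun w _ => sq_le_sq' (abs_le.mp (hE a w)).1 (abs_le.mp (hE a w)).2
        _ = _ := by simp
    have h3 : ∑ w, q w ^ 2 = q ⬝ᵥ q := by simp [dotProduct, sq]
    rw [h3] at h1
    have h4 : 0 ≤ q ⬝ᵥ q := aux_dot_nonneg q
    calc (E *ᵥ q) a * (E *ᵥ q) a = (∑ w, E a w * q w) ^ 2 := by
          rw [sq]; rfl
      _ ≤ _ := h1.trans (by gcongr)
  calc (E *ᵥ q) ⬝ᵥ (E *ᵥ q) ≤ ∑ a : Fin J, (J + 1) * δ ^ 2 * (q ⬝ᵥ q) :=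
        Finset.sum_le_sum fun a _ => h a
    _ = _ := by simp; ring

lemma aux_key (J : ℕ) (R S : Matrix (Fin J) (Fin (J + 1)) ℝ) (p : Fin (J + 1) → ℝ)
    (hp0 : ∀ w, 0 ≤ p w) (hp1 : ∑ w, p w = 1) (hRp : R *ᵥ p = 0)
    (ε : ℝ) (hε : 0 < ε)
    (hσ : ∀ v : Fin J → ℝ, ε ^ 2 * (v ⬝ᵥ v) ≤ v ⬝ᵥ ((R * Rᵀ) *ᵥ v))
    (δ η : ℝ) (hη : 0 < η) (hη1 : η ≤ 1)
    (hS : ∀ a w, |S a w - R a w| ≤ δ)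
    (hδ : 8 * (J + 2) * J * (J + 1) * δ ^ 2 ≤ ε ^ 2 * η ^ 2) :
    ∃ q : Fin (J + 1) → ℝ, (S *ᵥ q = 0 ∧ ∑ w, q w = 1) ∧
      (∀ q', S *ᵥ q' = 0 → ∑ w, q' w = 1 → q' = q) ∧ ∀ w, |q w - p w| ≤ η := by
  have hpp : p ⬝ᵥ p ≤ 1 := by
    rw [← hp1]
    refine Finset.sum_le_sum fun w _ => ?_
    have : p w ≤ 1 := by
      rw [← hp1]; exact Finset.single_le_sum (fun w _ => hp0 w) (Finset.mem_univ w)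
    exact mul_le_of_le_one_left (hp0 w) this
  have hE : ∀ a w, |(S - R) a w| ≤ δ := fun a w => by simpa using hS a w
  have hη2 : η ^ 2 ≤ 1 := by nlinarith
  have hbd : ∀ q : Fin (J + 1) → ℝ, ∑ w, q w = 0 →
      ε ^ 2 * (q ⬝ᵥ q) ≤ 8 * (J + 2) * ((S *ᵥ q) ⬝ᵥ (S *ᵥ q)) := by
    intro q hq
    have h1 := aux_bound J R p hp1 hpp hRp ε hε hσ q hq
    have h2 := aux_E J (S - R) δ hE q
    have h3 : (R *ᵥ q) ⬝ᵥ (R *ᵥ q) ≤ 2 * ((S *ᵥ q) ⬝ᵥ (S *ᵥ q)) +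
        2 * (((S - R) *ᵥ q) ⬝ᵥ ((S - R) *ᵥ q)) := by
      rw [Matrix.sub_mulVec]
      simp only [dotProduct, Finset.mul_sum, ← Finset.sum_add_distrib, Pi.sub_apply]
      refine Finset.sum_le_sum fun a _ => ?_
      nlinarith [sq_nonneg (2 * (S *ᵥ q) a - (R *ᵥ q) a)]
    have h4 : 0 ≤ q ⬝ᵥ q := aux_dot_nonneg q
    have h5 : 8 * (J + 2) * J * (J + 1) * δ ^ 2 * (q ⬝ᵥ q) ≤ ε ^ 2 * (q ⬝ᵥ q) := by
      refine mul_le_mul_of_nonneg_right (hδ.trans ?_) h4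
      exact mul_le_of_le_one_right (sq_nonneg ε) hη2
    have h6 : 2 * (J + 2 : ℝ) * ((R *ᵥ q) ⬝ᵥ (R *ᵥ q)) ≤ 2 * (J + 2) * (2 * ((S *ᵥ q) ⬝ᵥ (S *ᵥ q)) +
        2 * (J * (J + 1) * δ ^ 2 * (q ⬝ᵥ q))) := by
      refine mul_le_mul_of_nonneg_left (h3.trans (by linarith)) (by positivity)
    linarith
  have hε2 : 0 < ε ^ 2 := by positivity
  have hz : ∀ q : Fin (J + 1) → ℝ, ∑ w, q w = 0 → S *ᵥ q = 0 → q = 0 := by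
    intro q hq hSq
    have h := hbd q hq
    rw [hSq, dotProduct_zero, mul_zero] at h
    have h4 : 0 ≤ q ⬝ᵥ q := aux_dot_nonneg q
    have : q ⬝ᵥ q = 0 := by nlinarith
    exact dotProduct_self_eq_zero.mp this
  -- existence through the kernel of S
  have hex : ∃ q : Fin (J + 1) → ℝ, q ≠ 0 ∧ S *ᵥ q = 0 := by
    have : LinearMap.ker S.mulVecLin ≠ ⊥ := by
      apply LinearMap.ker_ne_bot_of_finrank_lt
      simp
    obtain ⟨q, hq, hq0⟩ := Submodule.exists_mem_ne_zero_of_ne_bot this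
    exact ⟨q, hq0, by simpa using hq⟩
  obtain ⟨q₀, hq₀, hSq₀⟩ := hex
  have hs : ∑ w, q₀ w ≠ 0 := fun h => hq₀ (hz q₀ h hSq₀)
  have hSq : S *ᵥ ((∑ w, q₀ w)⁻¹ • q₀) = 0 := by rw [Matrix.mulVec_smul, hSq₀, smul_zero]
  have hq1 : ∑ w, ((∑ w, q₀ w)⁻¹ • q₀) w = 1 := by
    simp only [Pi.smul_apply, smul_eq_mul, ← Finset.mul_sum]
    exact inv_mul_cancel₀ hs
  generalize (∑ w, q₀ w)⁻¹ • q₀ = q at hSq hq1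
  refine ⟨q, ⟨hSq, hq1⟩, ?_, ?_⟩
  · intro q' hq' hq1'
    have := hz (q' - q) (by simp [hq1, hq1']) (by rw [Matrix.mulVec_sub, hq', hSq, sub_zero])
    exact sub_eq_zero.mp this
  · intro w
    have h := hbd (q - p) (by simp [hq1, hp1])
    have h2 := aux_E J (S - R) δ hE p
    have h3 : (S *ᵥ (q - p)) ⬝ᵥ (S *ᵥ (q - p)) = ((S - R) *ᵥ p) ⬝ᵥ ((S - R) *ᵥ p) := by
      rw [Matrix.mulVec_sub, hSq, Matrix.sub_mulVec, hRp]; simp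
    rw [h3] at h
    have h4 : (q w - p w) ^ 2 ≤ (q - p) ⬝ᵥ (q - p) := by
      rw [sq]
      exact Finset.single_le_sum (f := fun w => (q - p) w * (q - p) w)
        (fun w _ => mul_self_nonneg _) (Finset.mem_univ w)
    have h5 : J * (J + 1) * δ ^ 2 * (p ⬝ᵥ p) ≤ J * (J + 1) * δ ^ 2 :=
      mul_le_of_le_one_right (by positivity) hpp
    have h6 : 8 * (J + 2 : ℝ) * (((S - R) *ᵥ p) ⬝ᵥ ((S - R) *ᵥ p)) ≤
        8 * (J + 2) * (J * (J + 1) * δ ^ 2) :=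
      mul_le_mul_of_nonneg_left (h2.trans h5) (by positivity)
    have h7 : ε ^ 2 * (q w - p w) ^ 2 ≤ ε ^ 2 * η ^ 2 := by
      have := mul_le_mul_of_nonneg_left h4 hε2.le
      linarith
    exact abs_le_of_sq_le_sq (le_of_mul_le_mul_left h7 hε2) hη.le

lemma aux_LI (J K : ℕ) (z : ℕ → Fin (J + 1) → Fin K → ℝ)
    (Λ : Matrix (Fin J) (Fin K) ℝ) (n : ℕ) (P : Measure (Fin n → Fin (J + 1)))
    (h : LevelIrrelevance J K z Λ n P) (i : Fin n) :
    Rmat J K z Λ n P i *ᵥ (fun w => (P {ω | ω i = w}).toReal) = 0 := by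
  have h1 := h (fun _ _ => 0) (Pi.single i 1)
  have hn : (n : ℝ) ≠ 0 := by
    have := i.pos
    positivity
  unfold tau at h1
  simp only [zero_add, mul_zero, zero_smul, Finset.sum_const_zero, smul_zero,
    Matrix.mulVec_zero] at h1
  rw [Matrix.mulVec_smul] at h1
  have h2 := (smul_eq_zero.mp h1).resolve_left (inv_ne_zero hn)
  rw [Finset.sum_eq_single i (by intro b _ hb; simp [hb]) (by simp)] at h2
  simp only [Pi.single_eq_same, mul_one] at h2
  rw [Matrix.mulVec_sum] at h2
  funext a
  have h3 := congrFun h2 a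
  simp only [Matrix.mulVec_smul, Finset.sum_apply, Pi.smul_apply, smul_eq_mul] at h3
  rw [← h3]
  simp [Matrix.mulVec, dotProduct, Rmat, rho, mul_comm]

lemma aux_main (J K : ℕ) (z : ℕ → Fin (J + 1) → Fin K → ℝ) (Λ : Matrix (Fin J) (Fin K) ℝ)
    (n : ℕ) (P : Measure (Fin n → Fin (J + 1))) (hP : IsProbabilityMeasure P)
    (hLI : LevelIrrelevance J K z Λ n P) (ε : ℝ) (hε : 0 < ε)
    (hσ : ∀ (i : Fin n) (v : Fin J → ℝ), ε ^ 2 * (v ⬝ᵥ v) ≤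
        v ⬝ᵥ ((Rmat J K z Λ n P i * (Rmat J K z Λ n P i)ᵀ) *ᵥ v))
    (δ η : ℝ) (hη : 0 < η) (hη1 : η ≤ 1)
    (hδ : 8 * (J + 2) * J * (J + 1) * δ ^ 2 ≤ ε ^ 2 * η ^ 2)
    (ω : Fin n → Fin (J + 1))
    (hω : ∀ (i : Fin n) (w : Fin (J + 1)) (a : Fin J),
      |rhoHat J K z Λ n ω i w a - rho J K z Λ n P i w a| ≤ δ) :
    ∃ q, EstImplicitDesign J K z Λ n ω q ∧
      (∀ q', EstImplicitDesign J K z Λ n ω q' → q' = q) ∧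
      ∀ i w, |q i w - (P {ω' | ω' i = w}).toReal| ≤ η := by
  have hp1 : ∀ i : Fin n, ∑ w, (P {ω' | ω' i = w}).toReal = 1 := by
    intro i
    have h := sum_measureReal_preimage_singleton (μ := P) (f := fun ω : Fin n → Fin (J + 1) => ω i)
      Finset.univ (fun y _ => MeasurableSet.of_discrete)
    simp at h
    simpa [Measure.real, Set.preimage] using h
  have key := fun i => aux_key J (Rmat J K z Λ n P i)
    (Matrix.of fun a w => rhoHat J K z Λ n ω i w a) (fun w => (P {ω' | ω' i = w}).toReal)
    (fun w => ENNReal.toReal_nonneg) (hp1 i) (aux_LI J K z Λ n P hLI i) ε hε (hσ i) δ η hη hη1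
    (fun a w => hω i w a) hδ
  have conv : ∀ (i : Fin n) (x : Fin (J + 1) → ℝ),
      (Matrix.of fun a w => rhoHat J K z Λ n ω i w a) *ᵥ x = 0 ↔
      ∀ a, ∑ w, x w * rhoHat J K z Λ n ω i w a = 0 := by
    intro i x
    rw [funext_iff]
    simp [Matrix.mulVec, dotProduct, mul_comm]
  choose q hq hu hb using key
  refine ⟨q, ⟨fun i => (conv i (q i)).mp (hq i).1, fun i => (hq i).2⟩, ?_, hb⟩
  intro q' hq'
  funext i
  exact hu i (q' i) ((conv i (q' i)).mpr (hq'.1 i)) (hq'.2 i)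

lemma aux_delta (J : ℕ) (ε η : ℝ) (hε : 0 < ε) (hη : 0 < η) :
    ∃ δ : ℝ, 0 < δ ∧ 8 * (J + 2) * J * (J + 1) * δ ^ 2 ≤ ε ^ 2 * η ^ 2 := by
  set D : ℝ := 8 * (J + 2) * J * (J + 1) with hD
  have hD0 : 0 ≤ D := by positivity
  refine ⟨ε * η / (D + 1), by positivity, ?_⟩
  rw [div_pow, mul_pow, ← mul_div_assoc, div_le_iff₀ (by positivity)]
  have : 0 ≤ ε ^ 2 * η ^ 2 := by positivity
  rw [mul_comm]
  exact mul_le_mul_of_nonneg_left (by nlinarith) this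

/-- consistency of estimated implicit designs, exactly determined
cross-sectional case `k = J`, `T = 1`: under level irrelevance, a uniform lower bound
`ε` on the smallest singular value of `R_i` (eventually in `n`), and uniform consistency
of the estimated potential weights, there is a `C > 0` such that with probability tending
to one a unique `C`-bounded estimated implicit design exists; and any selector `π̂` equal
to an estimated implicit design whenever one exists (and an arbitrary vector of
probability distributions otherwise) is uniformly consistent for the true marginals. -/
theorem estimated_implicit_design_consistent
    (J K : ℕ) (z : ℕ → Fin (J + 1) → Fin K → ℝ) (Λ : Matrix (Fin J) (Fin K) ℝ)
    (Pn : (n : ℕ) → Measure (Fin n → Fin (J + 1)))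
    (hP : ∀ n, IsProbabilityMeasure (Pn n))
    -- (i) the estimand is a vector of causal contrasts under the true design
    (hLI : ∀ n, LevelIrrelevance J K z Λ n (Pn n))
    -- (ii) smallest singular value of `R_i` uniformly bounded away from zero
    (ε : ℝ) (hε : 0 < ε)
    (hσ : ∀ᶠ n in atTop, ∀ (i : Fin n) (v : Fin J → ℝ),
      ε ^ 2 * (v ⬝ᵥ v) ≤
        v ⬝ᵥ ((Rmat J K z Λ n (Pn n) i * (Rmat J K z Λ n (Pn n) i)ᵀ) *ᵥ v))
    -- (iii) uniform consistency of the estimated potential weights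
    (hρ : ∀ ε' : ℝ, 0 < ε' →
      Tendsto (fun n => Pn n {ω | ∃ (i : Fin n) (w : Fin (J + 1)) (a : Fin J),
          ε' ≤ |rhoHat J K z Λ n ω i w a - rho J K z Λ n (Pn n) i w a|})
        atTop (nhds 0)) :
    (∃ C : ℝ, 0 < C ∧
      Tendsto (fun n => Pn n {ω | ∃! q : Fin n → Fin (J + 1) → ℝ,
          EstImplicitDesign J K z Λ n ω q ∧ ∀ (i : Fin n) (w : Fin (J + 1)), |q i w| ≤ C})
        atTop (nhds 1))
    ∧ (∀ sel : (n : ℕ) → (Fin n → Fin (J + 1)) → Fin n → Fin (J + 1) → ℝ,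
        (∀ (n : ℕ) (ω : Fin n → Fin (J + 1)),
          (∃ q, EstImplicitDesign J K z Λ n ω q) → EstImplicitDesign J K z Λ n ω (sel n ω)) →
        (∀ (n : ℕ) (ω : Fin n → Fin (J + 1)),
          (¬ ∃ q, EstImplicitDesign J K z Λ n ω q) →
            (∀ (i : Fin n) (w : Fin (J + 1)), 0 ≤ sel n ω i w)
            ∧ ∀ i : Fin n, ∑ w : Fin (J + 1), sel n ω i w = 1) →
        ∀ ε' : ℝ, 0 < ε' →
          Tendsto (fun n => Pn n {ω | ∃ (i : Fin n) (w : Fin (J + 1)),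
              ε' ≤ |sel n ω i w - (Pn n {ω' | ω' i = w}).toReal|})
            atTop (nhds 0)) := by
  refine ⟨⟨2, by norm_num, ?_⟩, ?_⟩
  · obtain ⟨δ, hδ0, hδ⟩ := aux_delta J ε 1 hε one_pos
    have hlim : Tendsto (fun n => 1 - Pn n {ω | ∃ (i : Fin n) (w : Fin (J + 1)) (a : Fin J),
          δ ≤ |rhoHat J K z Λ n ω i w a - rho J K z Λ n (Pn n) i w a|}) atTop (nhds 1) := by
      have := ENNReal.Tendsto.sub (tendsto_const_nhds (x := (1 : ENNReal)) (f := atTop)) (hρ δ hδ0)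
        (Or.inl ENNReal.one_ne_top)
      simpa using this
    refine tendsto_of_tendsto_of_tendsto_of_le_of_le' hlim tendsto_const_nhds ?_
      (Eventually.of_forall fun n => prob_le_one)
    filter_upwards [hσ] with n hn
    rw [← prob_compl_eq_one_sub MeasurableSet.of_discrete]
    refine measure_mono ?_
    intro ω hω
    simp only [Set.mem_compl_iff, Set.mem_setOf_eq, not_exists, not_le] at hω
    obtain ⟨q, hq, hu, hb⟩ := aux_main J K z Λ n (Pn n) (hP n) (hLI n) ε hε hn δ 1 one_pos le_rfl
      hδ ω (fun i w a => (hω i w a).le)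
    refine ⟨q, ⟨hq, fun i w => ?_⟩, fun q' hq' => hu q' hq'.1⟩
    have h1 := abs_le.mp (hb i w)
    have h2 : (Pn n {ω' | ω' i = w}).toReal ≤ 1 := measureReal_le_one
    have h3 : 0 ≤ (Pn n {ω' | ω' i = w}).toReal := ENNReal.toReal_nonneg
    rw [abs_le]
    constructor <;> linarith [h1.1, h1.2]
  · intro sel hsel _ ε' hε'
    have hη : 0 < min (ε' / 2) 1 := by positivity
    obtain ⟨δ, hδ0, hδ⟩ := aux_delta J ε (min (ε' / 2) 1) hε hη
    refine tendsto_of_tendsto_of_tendsto_of_le_of_le' tendsto_const_nhds (hρ δ hδ0)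
      (Eventually.of_forall fun n => zero_le) ?_
    filter_upwards [hσ] with n hn
    refine measure_mono ?_
    rintro ω ⟨i, w, hiw⟩
    by_contra hω
    simp only [Set.mem_setOf_eq, not_exists, not_le] at hω
    obtain ⟨q, hq, hu, hb⟩ := aux_main J K z Λ n (Pn n) (hP n) (hLI n) ε hε hn δ _ hη
      (min_le_right _ _) hδ ω (fun i w a => (hω i w a).le)
    rw [hu _ (hsel n ω ⟨q, hq⟩)] at hiw
    have := (hb i w).trans (min_le_left _ _)
    linarith

end Stmt17
end

section
/- Strong identification of the implicit design in cross-sections: in the cross-sectional setting (T=1) with 𝒲 = {0,1,…,J} and contrast matrix Λ = [I_J, 0] after reparametrization, partition z(x_i,w) into a J-dimensional block z_1 and a remaining block z_2, let Γ be the population projection matrix of z_1 on z_2 under π*, set z_{1|2}(x_i,w) = z_1(x_i,w) − Γ'z_2(x_i,w), and let G_{n,1|2} = (1/n) Σ_{i,w} π*_i(w) z_{1|2}(x_i,w) z_{1|2}(x_i,w)'. Assume: (i) λ_min(G_n) ≥ ε > 0 for all n; (ii) λ_max(G_n) ≤ M < ∞ for all n; (iii) the J×(J+1) matrix Z_i =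 [z_{1|2}(x_i,0),…,z_{1|2}(x_i,J)] has its J-th (smallest positive) singular value bounded below by η > 0 uniformly in i. Then the potential-weight matrix R_i = G_{n,1|2}^{-1} Z_i has its J-th singular value bounded below by η/M uniformly in i (so condition (ii) of the implicit-design consistency result is satisfied, and any implicit design, if it exists, is unique). -/
open Matrix BigOperators

namespace Stmt19

/-- Gram matrix of a design, covariate transform indexed by `Fin J ⊕ Fin K2`
(the first block carrying the contrasts `Λ = [I_J, 0]`). -/
noncomputable def gram (n J K2 : ℕ) (z : Fin n → Fin (J + 1) → (Fin J ⊕ Fin K2) → ℝ)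
    (πs : Fin n → Fin (J + 1) → ℝ) :
    Matrix (Fin J ⊕ Fin K2) (Fin J ⊕ Fin K2) ℝ :=
  (n : ℝ)⁻¹ • ∑ i : Fin n, ∑ w : Fin (J + 1), πs i w • vecMulVec (z i w) (z i w)

/-- Second-block empirical second-moment matrix `(1/n) Σ_{i,w} π*_i(w) z₂ z₂'`. -/
noncomputable def A22 (n J K2 : ℕ) (z : Fin n → Fin (J + 1) → (Fin J ⊕ Fin K2) → ℝ)
    (πs : Fin n → Fin (J + 1) → ℝ) : Matrix (Fin K2) (Fin K2) ℝ :=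
  (n : ℝ)⁻¹ • ∑ i : Fin n, ∑ w : Fin (J + 1),
    πs i w • vecMulVec (fun b => z i w (Sum.inr b)) (fun b => z i w (Sum.inr b))

/-- Cross-moment matrix `(1/n) Σ_{i,w} π*_i(w) z₂ z₁'`. -/
noncomputable def A21 (n J K2 : ℕ) (z : Fin n → Fin (J + 1) → (Fin J ⊕ Fin K2) → ℝ)
    (πs : Fin n → Fin (J + 1) → ℝ) : Matrix (Fin K2) (Fin J) ℝ :=
  (n : ℝ)⁻¹ • ∑ i : Fin n, ∑ w : Fin (J + 1),
    πs i w • vecMulVec (fun b => z i w (Sum.inr b)) (fun a => z i w (Sum.inl a))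

/-- Population projection matrix `Γ` of `z₁` on `z₂`. -/
noncomputable def Gamma (n J K2 : ℕ) (z : Fin n → Fin (J + 1) → (Fin J ⊕ Fin K2) → ℝ)
    (πs : Fin n → Fin (J + 1) → ℝ) : Matrix (Fin K2) (Fin J) ℝ :=
  (A22 n J K2 z πs)⁻¹ * A21 n J K2 z πs

/-- Residualized covariate transform `z_{1|2}(x_i,w) = z₁(x_i,w) - Γ'z₂(x_i,w)`. -/
noncomputable def z12 (n J K2 : ℕ) (z : Fin n → Fin (J + 1) → (Fin J ⊕ Fin K2) → ℝ)
    (πs : Fin n → Fin (J + 1) → ℝ) (i : Fin n) (w : Fin (J + 1)) : Fin J → ℝ :=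
  fun a => z i w (Sum.inl a) - ((Gamma n J K2 z πs)ᵀ *ᵥ fun b => z i w (Sum.inr b)) a

/-- `G_{n,1|2} = (1/n) Σ_{i,w} π*_i(w) z_{1|2} z_{1|2}'`. -/
noncomputable def G12 (n J K2 : ℕ) (z : Fin n → Fin (J + 1) → (Fin J ⊕ Fin K2) → ℝ)
    (πs : Fin n → Fin (J + 1) → ℝ) : Matrix (Fin J) (Fin J) ℝ :=
  (n : ℝ)⁻¹ • ∑ i : Fin n, ∑ w : Fin (J + 1),
    πs i w • vecMulVec (z12 n J K2 z πs i w) (z12 n J K2 z πs i w)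

/-- The matrix `Z_i = [z_{1|2}(x_i,0),…,z_{1|2}(x_i,J)]`. -/
noncomputable def Zmat (n J K2 : ℕ) (z : Fin n → Fin (J + 1) → (Fin J ⊕ Fin K2) → ℝ)
    (πs : Fin n → Fin (J + 1) → ℝ) (i : Fin n) : Matrix (Fin J) (Fin (J + 1)) ℝ :=
  Matrix.of fun a w => z12 n J K2 z πs i w a

/-- The potential-weight matrix `R_i = G_{n,1|2}⁻¹ Z_i`, whose columns are the
potential weights `ρ_i(w)` (by the population Frisch–Waugh–Lovell theorem). -/
noncomputable def Rmat (n J K2 : ℕ) (z : Fin n → Fin (J + 1) → (Fin J ⊕ Fin K2) → ℝ)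
    (πs : Fin n → Fin (J + 1) → ℝ) (i : Fin n) : Matrix (Fin J) (Fin (J + 1)) ℝ :=
  (G12 n J K2 z πs)⁻¹ * Zmat n J K2 z πs i

/-- `q` is an (improper) implicit design (in terms of the potential weights `R_i`). -/
def ImplicitDesign (n J K2 : ℕ) (z : Fin n → Fin (J + 1) → (Fin J ⊕ Fin K2) → ℝ)
    (πs : Fin n → Fin (J + 1) → ℝ) (q : Fin n → Fin (J + 1) → ℝ) : Prop :=
  (∀ (i : Fin n) (a : Fin J), ∑ w : Fin (J + 1), q i w * Rmat n J K2 z πs i a w = 0)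
  ∧ (∀ i, ∑ w : Fin (J + 1), q i w = 1)

lemma quad_form {ι κ α β : Type*} [Fintype ι] [Fintype κ] [Fintype α] [Fintype β]
    (c : ℝ) (p : ι → κ → ℝ) (a : ι → κ → α → ℝ) (b : ι → κ → β → ℝ) (x : α → ℝ) (y : β → ℝ) :
    x ⬝ᵥ ((c • ∑ i, ∑ w, p i w • vecMulVec (a i w) (b i w)) *ᵥ y)
      = c * ∑ i, ∑ w, p i w * ((x ⬝ᵥ a i w) * (b i w ⬝ᵥ y)) := by
  simp only [smul_mulVec, dotProduct_smul, Matrix.sum_mulVec, dotProduct_sum, vecMulVec_mulVec,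
    smul_eq_mul]
  congr 1

lemma norm_bound {m : Type*} [Fintype m] (G : Matrix m m ℝ) (M : ℝ) (hM : 0 < M)
    (hG : Gᵀ = G) (h0 : ∀ v, 0 ≤ v ⬝ᵥ (G *ᵥ v)) (h1 : ∀ v, v ⬝ᵥ (G *ᵥ v) ≤ M * (v ⬝ᵥ v))
    (y : m → ℝ) : (G *ᵥ y) ⬝ᵥ (G *ᵥ y) ≤ M ^ 2 * (y ⬝ᵥ y) := by
  have a := h0 (M • y - G *ᵥ y)
  have b := h1 (G *ᵥ y)
  have c := h1 y
  have e : y ⬝ᵥ (G *ᵥ (G *ᵥ y)) = (G *ᵥ y) ⬝ᵥ (G *ᵥ y) := by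
    rw [dotProduct_mulVec, ← mulVec_transpose, hG]
  simp only [mulVec_sub, mulVec_smul, sub_dotProduct, dotProduct_sub, smul_dotProduct,
    dotProduct_smul, smul_eq_mul, e] at a
  have d : M * ((G *ᵥ y) ⬝ᵥ (G *ᵥ y)) ≤ M * (M * (y ⬝ᵥ (G *ᵥ y))) := by nlinarith
  have d' := le_of_mul_le_mul_left d hM
  nlinarith

lemma isUnit_of_form {m : Type*} [Fintype m] [DecidableEq m] (G : Matrix m m ℝ) (ε : ℝ)
    (hε : 0 < ε) (h : ∀ v, ε * (v ⬝ᵥ v) ≤ v ⬝ᵥ (G *ᵥ v)) : IsUnit G.det := by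
  rw [isUnit_iff_ne_zero]
  intro h0
  obtain ⟨v, hv, hv0⟩ := Matrix.exists_mulVec_eq_zero_iff.mpr h0
  have := h v
  rw [hv0, dotProduct_zero] at this
  have h2 : v ⬝ᵥ v ≤ 0 := by
    by_contra h3
    push Not at h3
    nlinarith [mul_pos hε h3]
  have h4 : 0 ≤ v ⬝ᵥ v := Finset.sum_nonneg fun i _ => mul_self_nonneg (v i)
  exact hv (dotProduct_self_eq_zero.mp (le_antisymm h2 h4))

lemma unique_ker {J : ℕ} (R : Matrix (Fin J) (Fin (J + 1)) ℝ) (c : ℝ) (hc : 0 < c)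
    (hR : ∀ v : Fin J → ℝ, c * (v ⬝ᵥ v) ≤ v ⬝ᵥ ((R * Rᵀ) *ᵥ v))
    (q q' : Fin (J + 1) → ℝ) (h : R *ᵥ q = 0) (h' : R *ᵥ q' = 0)
    (hs : ∑ w, q w = 1) (hs' : ∑ w, q' w = 1) : q = q' := by
  let L : ((Fin J → ℝ) × ℝ) →ₗ[ℝ] (Fin (J + 1) → ℝ) :=
    (Rᵀ.mulVecLin).coprod (LinearMap.toSpanSingleton ℝ _ (fun _ => (1 : ℝ)))
  have hL : ∀ v t, L (v, t) = Rᵀ *ᵥ v + t • (fun _ => (1 : ℝ)) := fun v t => by simp [L, mulVec_transpose]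
  have hd : ∀ (d : Fin (J + 1) → ℝ) v t, R *ᵥ d = 0 → d ⬝ᵥ L (v, t) = t * ∑ w, d w := by
    intro d v t hd
    rw [hL, dotProduct_add, dotProduct_mulVec, vecMul_transpose, hd, zero_dotProduct, zero_add,
      dotProduct_smul, smul_eq_mul]
    simp [dotProduct]
  have inj : Function.Injective L := by
    rw [injective_iff_map_eq_zero]
    rintro ⟨v, t⟩ h0
    have ht := hd q v t h
    rw [h0, hs, dotProduct_zero, mul_one] at ht
    subst ht
    have hv : Rᵀ *ᵥ v = 0 := by simpa [hL] using h0
    have := hR v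
    rw [← mulVec_mulVec, hv, mulVec_zero, dotProduct_zero] at this
    have h4 : 0 ≤ v ⬝ᵥ v := Finset.sum_nonneg fun i _ => mul_self_nonneg (v i)
    have h5 : v ⬝ᵥ v = 0 := by
      refine le_antisymm ?_ h4
      by_contra h3
      push Not at h3
      nlinarith [mul_pos hc h3]
    rw [dotProduct_self_eq_zero.mp h5]
    rfl
  have surj : Function.Surjective L :=
    (LinearMap.injective_iff_surjective_of_finrank_eq_finrank (by simp)).mp inj
  obtain ⟨⟨v, t⟩, hvt⟩ := surj (q - q')
  have := hd (q - q') v t (by rw [mulVec_sub, h, h', sub_zero])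
  rw [hvt] at this
  have hz : ∑ w, (q - q') w = 0 := by simp [hs, hs']
  rw [hz, mul_zero] at this
  exact sub_eq_zero.mp (dotProduct_self_eq_zero.mp this)

lemma dot_z12 (n J K2 : ℕ) (z : Fin n → Fin (J + 1) → (Fin J ⊕ Fin K2) → ℝ)
    (πs : Fin n → Fin (J + 1) → ℝ) (i : Fin n) (w : Fin (J + 1)) (u : Fin J → ℝ) :
    u ⬝ᵥ z12 n J K2 z πs i w = u ⬝ᵥ (fun a => z i w (Sum.inl a))
      - (Gamma n J K2 z πs *ᵥ u) ⬝ᵥ (fun b => z i w (Sum.inr b)) := by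
  have : z12 n J K2 z πs i w = (fun a => z i w (Sum.inl a))
    - (Gamma n J K2 z πs)ᵀ *ᵥ (fun b => z i w (Sum.inr b)) := rfl
  rw [this, dotProduct_sub, dotProduct_mulVec, vecMul_transpose]

lemma dot_elim {J K2 : ℕ} (u : Fin J → ℝ) (b : Fin K2 → ℝ) (y : Fin J ⊕ Fin K2 → ℝ) :
    Sum.elim u b ⬝ᵥ y = u ⬝ᵥ (fun a => y (Sum.inl a)) + b ⬝ᵥ (fun a => y (Sum.inr a)) := by
  simp [dotProduct]

/-- strong identification of the implicit design in cross-sections: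
if `λ_min(G_n) ≥ ε > 0`, `λ_max(G_n) ≤ M`, and the smallest singular value of `Z_i` is
at least `η > 0` uniformly in `i`, then the smallest singular value of
`R_i = G_{n,1|2}⁻¹ Z_i` is at least `η/M` uniformly in `i`; in particular any implicit
design, if it exists, is unique. -/
theorem strong_identification
    (n J K2 : ℕ) (z : Fin n → Fin (J + 1) → (Fin J ⊕ Fin K2) → ℝ)
    (πs : Fin n → Fin (J + 1) → ℝ)
    (hpos : ∀ i w, 0 ≤ πs i w) (hsum : ∀ i, ∑ w : Fin (J + 1), πs i w = 1)
    (ε : ℝ) (hε : 0 < ε)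
    (hlo : ∀ v : (Fin J ⊕ Fin K2) → ℝ, ε * (v ⬝ᵥ v) ≤ v ⬝ᵥ (gram n J K2 z πs *ᵥ v))
    (M : ℝ) (hM : 0 < M)
    (hhi : ∀ v : (Fin J ⊕ Fin K2) → ℝ, v ⬝ᵥ (gram n J K2 z πs *ᵥ v) ≤ M * (v ⬝ᵥ v))
    (η : ℝ) (hη : 0 < η)
    (hZ : ∀ (i : Fin n) (v : Fin J → ℝ),
      η ^ 2 * (v ⬝ᵥ v) ≤ v ⬝ᵥ ((Zmat n J K2 z πs i * (Zmat n J K2 z πs i)ᵀ) *ᵥ v)) :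
    (∀ (i : Fin n) (v : Fin J → ℝ),
      (η / M) ^ 2 * (v ⬝ᵥ v) ≤ v ⬝ᵥ ((Rmat n J K2 z πs i * (Rmat n J K2 z πs i)ᵀ) *ᵥ v))
    ∧ (∀ q q' : Fin n → Fin (J + 1) → ℝ, ImplicitDesign n J K2 z πs q →
        ImplicitDesign n J K2 z πs q' → q = q') := by
  have sq0 : ∀ {m : ℕ} (v : Fin m → ℝ), 0 ≤ v ⬝ᵥ v :=
    fun v => Finset.sum_nonneg fun i _ => mul_self_nonneg (v i)
  have fg : ∀ x y, x ⬝ᵥ (gram n J K2 z πs *ᵥ y)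
      = (n : ℝ)⁻¹ * ∑ i, ∑ w, πs i w * ((x ⬝ᵥ z i w) * (z i w ⬝ᵥ y)) :=
    fun x y => quad_form _ _ _ _ x y
  have f22 : ∀ x y, x ⬝ᵥ (A22 n J K2 z πs *ᵥ y) = (n : ℝ)⁻¹ * ∑ i, ∑ w, πs i w *
      ((x ⬝ᵥ fun b => z i w (Sum.inr b)) * ((fun b => z i w (Sum.inr b)) ⬝ᵥ y)) :=
    fun x y => quad_form _ _ _ _ x y
  have f21 : ∀ x y, x ⬝ᵥ (A21 n J K2 z πs *ᵥ y) = (n : ℝ)⁻¹ * ∑ i, ∑ w, πs i w *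
      ((x ⬝ᵥ fun b => z i w (Sum.inr b)) * ((fun b => z i w (Sum.inl b)) ⬝ᵥ y)) :=
    fun x y => quad_form _ _ _ _ x y
  have f12 : ∀ x y, x ⬝ᵥ (G12 n J K2 z πs *ᵥ y) = (n : ℝ)⁻¹ * ∑ i, ∑ w, πs i w *
      ((x ⬝ᵥ z12 n J K2 z πs i w) * (z12 n J K2 z πs i w ⬝ᵥ y)) :=
    fun x y => quad_form _ _ _ _ x y
  have hU22 : IsUnit (A22 n J K2 z πs).det := by
    refine isUnit_of_form _ ε hε fun b => ?_
    have h := hlo (Sum.elim 0 b)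
    rw [fg] at h
    simp only [dotProduct_comm (z _ _) (Sum.elim _ _), dot_elim, zero_dotProduct, zero_add,
      Sum.elim_inr] at h
    rw [f22]
    simpa only [dotProduct_comm (fun b => z _ _ (Sum.inr b)) b] using h
  have hGam : A22 n J K2 z πs * Gamma n J K2 z πs = A21 n J K2 z πs := by
    rw [Gamma, Matrix.mul_nonsing_inv_cancel_left _ _ hU22]
  have hsymm : (G12 n J K2 z πs)ᵀ = G12 n J K2 z πs := by
    simp [G12, transpose_smul, transpose_sum, transpose_vecMulVec]
  have hlo12 : ∀ u, ε * (u ⬝ᵥ u) ≤ u ⬝ᵥ (G12 n J K2 z πs *ᵥ u) := by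
    intro u
    have h := hlo (Sum.elim u (-(Gamma n J K2 z πs *ᵥ u)))
    rw [fg] at h
    simp only [dotProduct_comm (z _ _) (Sum.elim _ _), dot_elim, neg_dotProduct, dotProduct_neg,
      Sum.elim_inr, Sum.elim_inl, Pi.neg_apply, ← sub_eq_add_neg, ← dot_z12] at h
    rw [f12]
    simp only [dotProduct_comm (z12 _ _ _ _ _ _ _) u]
    refine le_trans (mul_le_mul_of_nonneg_left ?_ hε.le) h
    have := sq0 (Gamma n J K2 z πs *ᵥ u)
    have e : (-(Gamma n J K2 z πs *ᵥ u)) ⬝ᵥ (-(Gamma n J K2 z πs *ᵥ u))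
      = (Gamma n J K2 z πs *ᵥ u) ⬝ᵥ (Gamma n J K2 z πs *ᵥ u) := by simp
    change _ ≤ u ⬝ᵥ u - _ ⬝ᵥ (-(Gamma n J K2 z πs *ᵥ u))
    rw [dotProduct_neg]
    linarith
  have hhi12 : ∀ u, u ⬝ᵥ (G12 n J K2 z πs *ᵥ u) ≤ M * (u ⬝ᵥ u) := by
    intro u
    have h := hhi (Sum.elim u 0)
    rw [fg] at h
    simp only [dotProduct_comm (z _ _) (Sum.elim _ _), dot_elim, zero_dotProduct, add_zero,
      Sum.elim_inl] at h
    refine le_trans ?_ h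
    have e1 := f22 (Gamma n J K2 z πs *ᵥ u) (Gamma n J K2 z πs *ᵥ u)
    have e2 := f21 (Gamma n J K2 z πs *ᵥ u) u
    rw [mulVec_mulVec, hGam] at e1
    rw [f12]
    simp only [dotProduct_comm (z12 _ _ _ _ _ _ _) u, dot_z12]
    simp only [dotProduct_comm (fun b => z _ _ (Sum.inr b)) _,
      dotProduct_comm (fun b => z _ _ (Sum.inl b)) _] at e1 e2
    set s : Fin n → Fin (J + 1) → ℝ :=
      fun i w => (Gamma n J K2 z πs *ᵥ u) ⬝ᵥ fun b => z i w (Sum.inr b) with hs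
    set p : Fin n → Fin (J + 1) → ℝ := fun i w => u ⬝ᵥ fun b => z i w (Sum.inl b) with hp
    change _ = (n : ℝ)⁻¹ * ∑ i, ∑ w, πs i w * (s i w * s i w) at e1
    change _ = (n : ℝ)⁻¹ * ∑ i, ∑ w, πs i w * (s i w * p i w) at e2
    change (n : ℝ)⁻¹ * ∑ i, ∑ w, πs i w * ((p i w - s i w) * (p i w - s i w))
      ≤ (n : ℝ)⁻¹ * ∑ i, ∑ w, πs i w * (p i w * p i w)
    have e3 : (n : ℝ)⁻¹ * ∑ i, ∑ w, πs i w * ((p i w - s i w) * (p i w - s i w))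
      = (n : ℝ)⁻¹ * ∑ i, ∑ w, πs i w * (p i w * p i w)
        - 2 * ((n : ℝ)⁻¹ * ∑ i, ∑ w, πs i w * (s i w * p i w))
        + (n : ℝ)⁻¹ * ∑ i, ∑ w, πs i w * (s i w * s i w) := by
      simp only [Finset.mul_sum, ← Finset.sum_sub_distrib, ← Finset.sum_add_distrib]
      refine Finset.sum_congr rfl fun i _ => Finset.sum_congr rfl fun w _ => ?_
      ring
    have e4 : 0 ≤ (n : ℝ)⁻¹ * ∑ i, ∑ w, πs i w * (s i w * s i w) :=
      mul_nonneg (by positivity) (Finset.sum_nonneg fun i _ => Finset.sum_nonneg fun w _ =>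
        mul_nonneg (hpos i w) (mul_self_nonneg _))
    linarith
  have hU : IsUnit (G12 n J K2 z πs).det := isUnit_of_form _ ε hε hlo12
  have main : ∀ (i : Fin n) (v : Fin J → ℝ),
      (η / M) ^ 2 * (v ⬝ᵥ v)
        ≤ v ⬝ᵥ ((Rmat n J K2 z πs i * (Rmat n J K2 z πs i)ᵀ) *ᵥ v) := by
    intro i v
    set y := (G12 n J K2 z πs)⁻¹ *ᵥ v with hy
    have hv : G12 n J K2 z πs *ᵥ y = v := by
      rw [hy, mulVec_mulVec, Matrix.mul_nonsing_inv _ hU, one_mulVec]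
    have h1 := norm_bound _ M hM hsymm
      (fun v => le_trans (mul_nonneg hε.le (sq0 v)) (hlo12 v)) hhi12 y
    rw [hv] at h1
    have hRR : v ⬝ᵥ ((Rmat n J K2 z πs i * (Rmat n J K2 z πs i)ᵀ) *ᵥ v)
        = y ⬝ᵥ ((Zmat n J K2 z πs i * (Zmat n J K2 z πs i)ᵀ) *ᵥ y) := by
      have hinv : ((G12 n J K2 z πs)⁻¹)ᵀ = (G12 n J K2 z πs)⁻¹ := by
        rw [transpose_nonsing_inv, hsymm]
      rw [Rmat, transpose_mul, hinv, Matrix.mul_assoc, ← Matrix.mul_assoc (Zmat n J K2 z πs i),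
        ← mulVec_mulVec, ← mulVec_mulVec, dotProduct_mulVec v, ← mulVec_transpose, hinv]
    rw [hRR]
    refine le_trans ?_ (hZ i y)
    rw [div_pow, div_mul_eq_mul_div, div_le_iff₀ (by positivity)]
    nlinarith [mul_le_mul_of_nonneg_left h1 (sq_nonneg η)]
  refine ⟨main, fun q q' hq hq' => funext fun i => ?_⟩
  refine unique_ker (Rmat n J K2 z πs i) ((η / M) ^ 2) (by positivity) (main i) _ _ ?_ ?_
    (hq.2 i) (hq'.2 i)
  · funext a
    simpa [mulVec, dotProduct, mul_comm] using hq.1 i a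
  · funext a
    simpa [mulVec, dotProduct, mul_comm] using hq'.1 i a

end Stmt19
end
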